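/- arXiv:1210.5705 — 2 statements merged into one kernel-verified Lean document; each statement's English description precedes it below -/
import Mathlib

section
/- Let n ≥ 2 be an integer and α ∈ ℝ. The infimum, over all radially symmetric functions u : ℝⁿ → ℝ of class C² with compact support contained in ℝⁿ \ {0} and with ∫_{ℝⁿ} |x|^{α-2} |∇u(x)|² dx ≠ 0, of the quotient (∫_{ℝⁿ} |x|^α |Δu(x)|² dx) / (∫_{ℝⁿ} |x|^{α-2} |∇u(x)|² dx) equals ((n-α)/2)². -/
open MeasureTheory

noncomputable def lap {n : ℕ} (u : EuclideanSpace ℝ (Fin n) → ℝ)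
    (x : EuclideanSpace ℝ (Fin n)) : ℝ :=
  ∑ i : Fin n, iteratedFDeriv ℝ 2 u x ![EuclideanSpace.single i 1, EuclideanSpace.single i 1]

open Real Set

/-- In polar coordinates `‖x‖ = exp t`, the integral of a radial function is a weighted integral
over the real line. -/
theorem integral_comp_log_norm {n : ℕ} (hn : 1 ≤ n) (G : ℝ → ℝ) :
    ∫ x : EuclideanSpace ℝ (Fin n), G (log ‖x‖) =
      (n * volume.real (Metric.ball (0 : EuclideanSpace ℝ (Fin n)) 1)) *
        ∫ t, exp (n * t) * G t := by
  have : Nonempty (Fin n) := ⟨⟨0, hn⟩⟩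
  rw [integral_fun_norm_addHaar volume (fun r => G (log r)), ← range_exp, ← image_univ,
    integral_image_eq_integral_abs_deriv_smul MeasurableSet.univ
      (fun t _ => (hasDerivAt_exp t).hasDerivWithinAt) exp_injective.injOn]
  simp only [finrank_euclideanSpace, Fintype.card_fin, nsmul_eq_mul, smul_eq_mul, setIntegral_univ,
    log_exp, abs_exp, mul_assoc]
  congr 3
  ext t
  rw [← mul_assoc, ← pow_succ', Nat.sub_add_cancel hn, ← exp_nat_mul]

theorem hasFDerivAt_comp_log_norm {E : Type*} [NormedAddCommGroup E] [InnerProductSpace ℝ E]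
    {F : ℝ → ℝ} {F' : ℝ} {x : E} (hx : x ≠ 0) (hF : HasDerivAt F F' (log ‖x‖)) :
    HasFDerivAt (fun y : E => F (log ‖y‖)) ((exp (-2 * log ‖x‖) * F') • innerSL ℝ x) x := by
  have hx' : 0 < ‖x‖ := norm_pos_iff.2 hx
  have hlog : (fun y : E => log ‖y‖) = fun y => (1 / 2 : ℝ) * log (‖y‖ ^ 2) := by
    ext y
    rw [log_pow]
    push_cast
    ring
  have h := ((hasFDerivAt_id (𝕜 := ℝ) x).norm_sq.log (pow_ne_zero 2 hx'.ne')).const_mul (1 / 2 : ℝ)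
  simp only [id] at h
  rw [← hlog] at h
  refine (hF.comp_hasFDerivAt x h).congr_fderiv ?_
  have he : exp (-2 * log ‖x‖) = (‖x‖ ^ 2)⁻¹ := by
    rw [neg_mul, exp_neg, mul_comm, exp_mul, exp_log hx', rpow_two]
  rw [he]
  ext v
  simp
  ring

section Radial

variable {n : ℕ} {c : ℝ} {u : EuclideanSpace ℝ (Fin n) → ℝ} {F k k' : ℝ → ℝ}

theorem hasFDerivAt_of_radial (hu : ∀ x, x ≠ 0 → u x = F (log ‖x‖))
    (hF : ∀ t, HasDerivAt F (exp (-c * t) * k t) t) {x : EuclideanSpace ℝ (Fin n)} (hx : x ≠ 0) :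
    HasFDerivAt u ((exp (-(c + 2) * log ‖x‖) * k (log ‖x‖)) • innerSL ℝ x) x := by
  have h := hasFDerivAt_comp_log_norm hx (hF (log ‖x‖))
  rw [← mul_assoc, ← exp_add] at h
  refine (h.congr_of_eventuallyEq ?_).congr_fderiv ?_
  · filter_upwards [isOpen_ne.mem_nhds hx] with y hy using hu y hy
  · ring_nf

theorem norm_gradient_of_radial (hu : ∀ x, x ≠ 0 → u x = F (log ‖x‖))
    (hF : ∀ t, HasDerivAt F (exp (-c * t) * k t) t) {x : EuclideanSpace ℝ (Fin n)} (hx : x ≠ 0) :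
    ‖gradient u x‖ ^ 2 = exp (-(2 * c + 2) * log ‖x‖) * k (log ‖x‖) ^ 2 := by
  have hx' : 0 < ‖x‖ := norm_pos_iff.2 hx
  rw [gradient, LinearIsometryEquiv.norm_map, (hasFDerivAt_of_radial hu hF hx).fderiv, norm_smul,
    innerSL_apply_norm, mul_pow, Real.norm_eq_abs, sq_abs, mul_pow]
  nth_rw 3 [← exp_log hx']
  rw [mul_right_comm, ← exp_nat_mul, ← exp_nat_mul, ← exp_add]
  push_cast
  ring_nf

theorem lap_of_radial (hu : ∀ x, x ≠ 0 → u x = F (log ‖x‖))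
    (hF : ∀ t, HasDerivAt F (exp (-c * t) * k t) t) (hk : ∀ t, HasDerivAt k (k' t) t)
    {x : EuclideanSpace ℝ (Fin n)} (hx : x ≠ 0) :
    lap u x = exp (-(c + 2) * log ‖x‖) * (k' (log ‖x‖) + (n - 2 - c) * k (log ‖x‖)) := by
  have hx' : 0 < ‖x‖ := norm_pos_iff.2 hx
  have hexp (t : ℝ) : HasDerivAt (fun s => exp (-(c + 2) * s) * k s)
      (exp (-(c + 2) * t) * (k' t - (c + 2) * k t)) t := by
    refine (((hasDerivAt_id t).const_mul (-(c + 2))).exp.mul (hk t)).congr_deriv ?_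
    simp only [id]
    ring
  have hcoef := hasFDerivAt_comp_log_norm hx (hexp (log ‖x‖))
  have hD := (hcoef.smul
    (innerSL ℝ (E := EuclideanSpace ℝ (Fin n))).hasFDerivAt).congr_of_eventuallyEq
    (f₁ := fderiv ℝ u) (by
      filter_upwards [isOpen_ne.mem_nhds hx] with y hy using (hasFDerivAt_of_radial hu hF hy).fderiv)
  have hnorm : ∑ i, x i * x i = exp (2 * log ‖x‖) := by
    rw [mul_comm, exp_mul, exp_log hx', rpow_two, EuclideanSpace.norm_sq_eq]
    simp [sq]
  have hone : exp (-2 * log ‖x‖) * exp (2 * log ‖x‖) = 1 := by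
    rw [← exp_add]; simp
  have happ (v w : EuclideanSpace ℝ (Fin n)) : fderiv ℝ (fderiv ℝ u) x v w =
      exp (-(c + 2) * log ‖x‖) * k (log ‖x‖) * inner ℝ v w +
        exp (-2 * log ‖x‖) * (exp (-(c + 2) * log ‖x‖) * (k' (log ‖x‖) - (c + 2) * k (log ‖x‖))) *
          inner ℝ x v * inner ℝ x w := by
    rw [hD.fderiv]
    rfl
  simp only [lap, iteratedFDeriv_two_apply, Matrix.cons_val_zero, Matrix.cons_val_one, happ,
    EuclideanSpace.inner_single_right, Finset.sum_add_distrib, mul_assoc, ← Finset.mul_sum]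
  simp only [PiLp.single_apply, conj_trivial, one_mul, hnorm, if_true, Finset.sum_const,
    Finset.card_univ, Fintype.card_fin, nsmul_eq_mul, mul_one]
  linear_combination
    exp (-(c + 2) * log ‖x‖) * (k' (log ‖x‖) - (c + 2) * k (log ‖x‖)) * hone

theorem integral_gradient_of_radial (hn : 1 ≤ n) {α : ℝ} (hc : 2 * c = n + α - 4)
    (hu : ∀ x, x ≠ 0 → u x = F (log ‖x‖)) (hF : ∀ t, HasDerivAt F (exp (-c * t) * k t) t) :
    ∫ x, ‖x‖ ^ (α - 2) * ‖gradient u x‖ ^ 2 =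
      (n * volume.real (Metric.ball (0 : EuclideanSpace ℝ (Fin n)) 1)) * ∫ t, k t ^ 2 := by
  have : Nonempty (Fin n) := ⟨⟨0, hn⟩⟩
  have hint := integral_comp_log_norm hn (fun t => exp (-n * t) * k t ^ 2)
  simp only [← mul_assoc, ← exp_add] at hint
  simp only [neg_mul, add_neg_cancel, exp_zero, one_mul] at hint
  rw [← hint]
  refine integral_congr_ae ?_
  filter_upwards [compl_mem_ae_iff.2 (measure_singleton 0)] with x hx
  have hx : x ≠ 0 := hx
  rw [norm_gradient_of_radial hu hF hx, rpow_def_of_pos (norm_pos_iff.2 hx), ← mul_assoc, ← exp_add,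
    hc]
  ring_nf

theorem integral_lap_of_radial (hn : 1 ≤ n) {α : ℝ} (hc : 2 * c = n + α - 4)
    (hu : ∀ x, x ≠ 0 → u x = F (log ‖x‖)) (hF : ∀ t, HasDerivAt F (exp (-c * t) * k t) t)
    (hk : ∀ t, HasDerivAt k (k' t) t) :
    ∫ x, ‖x‖ ^ α * lap u x ^ 2 =
      (n * volume.real (Metric.ball (0 : EuclideanSpace ℝ (Fin n)) 1)) *
        ∫ t, (k' t + (n - α) / 2 * k t) ^ 2 := by
  have : Nonempty (Fin n) := ⟨⟨0, hn⟩⟩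
  have hint := integral_comp_log_norm hn (fun t => exp (-n * t) * (k' t + (n - α) / 2 * k t) ^ 2)
  simp only [← mul_assoc, ← exp_add] at hint
  simp only [neg_mul, add_neg_cancel, exp_zero, one_mul] at hint
  rw [← hint]
  refine integral_congr_ae ?_
  filter_upwards [compl_mem_ae_iff.2 (measure_singleton 0)] with x hx
  have hx : x ≠ 0 := hx
  have hm : (n : ℝ) - 2 - c = (n - α) / 2 := by linarith
  rw [lap_of_radial hu hF hk hx, rpow_def_of_pos (norm_pos_iff.2 hx), mul_pow, ← exp_nat_mul,
    ← mul_assoc, ← exp_add, hm]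
  congr 2
  push_cast
  linear_combination (-log ‖x‖) * hc

end Radial

theorem integrable_sq_of_hasCompactSupport {f : ℝ → ℝ} (hf : Continuous f)
    (hs : HasCompactSupport f) : Integrable fun t => f t ^ 2 := by
  simp only [sq]
  exact (hf.mul hf).integrable_of_hasCompactSupport (hs.mul_left (f := f))

/-- Expanding the square, the cross term integrates to zero. -/
theorem integral_deriv_add_const_mul_sq {k k' : ℝ → ℝ} (hk : ∀ t, HasDerivAt k (k' t) t)
    (hk' : Continuous k') (hs : HasCompactSupport k) (m : ℝ) :
    ∫ t, (k' t + m * k t) ^ 2 = (∫ t, k' t ^ 2) + m ^ 2 * ∫ t, k t ^ 2 := by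
  have hkc : Continuous k := continuous_iff_continuousAt.2 fun t => (hk t).continuousAt
  have hs' : HasCompactSupport k' := by
    rw [← funext fun t => (hk t).deriv]
    exact hs.deriv
  have hsq := integrable_sq_of_hasCompactSupport hkc hs
  have hsq' := integrable_sq_of_hasCompactSupport hk' hs'
  have hcross : Integrable fun t => 2 * (k t * k' t) :=
    ((hkc.mul hk').integrable_of_hasCompactSupport hs.mul_right).const_mul 2
  have hzero : ∫ t, 2 * (k t * k' t) = 0 := by
    refine integral_eq_zero_of_hasDerivAt_of_integrable (f := fun t => k t ^ 2) (fun t => ?_)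
      hcross hsq
    refine ((hk t).pow 2).congr_deriv ?_
    push_cast
    ring
  have hexpand : (fun t => (k' t + m * k t) ^ 2) =
      fun t => (k' t ^ 2 + m ^ 2 * k t ^ 2) + m * (2 * (k t * k' t)) := by
    ext t
    ring
  have hsum : Integrable fun t => k' t ^ 2 + m ^ 2 * k t ^ 2 := hsq'.add (hsq.const_mul _)
  rw [hexpand, integral_add hsum (hcross.const_mul _),
    integral_add hsq' (hsq.const_mul _), integral_const_mul, integral_const_mul, hzero]
  ring

theorem integrals_of_profile {n : ℕ} (hn : 1 ≤ n) {α c : ℝ} (hc : 2 * c = n + α - 4)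
    {u : EuclideanSpace ℝ (Fin n) → ℝ} {h : ℝ → ℝ} (hh : ContDiff ℝ 2 h)
    (hs : HasCompactSupport h) (hu : ∀ x, x ≠ 0 → u x = exp (-c * log ‖x‖) * h (log ‖x‖)) :
    (∫ x, ‖x‖ ^ (α - 2) * ‖gradient u x‖ ^ 2 =
      (n * volume.real (Metric.ball (0 : EuclideanSpace ℝ (Fin n)) 1)) *
        ((∫ t, deriv h t ^ 2) + c ^ 2 * ∫ t, h t ^ 2)) ∧
    (∫ x, ‖x‖ ^ α * lap u x ^ 2 =
      (n * volume.real (Metric.ball (0 : EuclideanSpace ℝ (Fin n)) 1)) *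
        (((∫ t, deriv (deriv h) t ^ 2) + c ^ 2 * ∫ t, deriv h t ^ 2) +
          ((n - α) / 2) ^ 2 * ((∫ t, deriv h t ^ 2) + c ^ 2 * ∫ t, h t ^ 2))) := by
  have hh1 : ContDiff ℝ 1 (deriv h) := hh.deriv'
  have hd (t : ℝ) : HasDerivAt h (deriv h t) t :=
    (hh.differentiable (by norm_num) t).hasDerivAt
  have hd' (t : ℝ) : HasDerivAt (deriv h) (deriv (deriv h) t) t :=
    (hh1.differentiable (by norm_num) t).hasDerivAt
  have hcont' : Continuous (deriv (deriv h)) := hh1.continuous_deriv le_rfl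
  have hF (t : ℝ) : HasDerivAt (fun s => exp (-c * s) * h s)
      (exp (-c * t) * (deriv h t + -c * h t)) t := by
    refine (((hasDerivAt_id t).const_mul (-c)).exp.mul (hd t)).congr_deriv ?_
    simp only [id]
    ring
  have hk (t : ℝ) : HasDerivAt (fun s => deriv h s + -c * h s)
      (deriv (deriv h) t + -c * deriv h t) t := (hd' t).add ((hd t).const_mul (-c))
  have hks : HasCompactSupport fun s => deriv h s + -c * h s :=
    hs.deriv.add (hs.mul_left (f := fun _ => -c))
  have h1 := integral_deriv_add_const_mul_sq hd hh1.continuous hs (-c)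
  have h2 := integral_deriv_add_const_mul_sq hd' hcont' hs.deriv (-c)
  rw [neg_sq] at h1 h2
  rw [integral_gradient_of_radial hn hc hu hF, integral_lap_of_radial hn hc hu hF hk,
    integral_deriv_add_const_mul_sq hk (hcont'.add (hh1.continuous.const_smul (-c))) hks, h1, h2]
  exact ⟨rfl, rfl⟩

/-- A radial function supported away from the origin has a compactly supported profile in the
variable `log ‖x‖`. -/
theorem exists_profile {n : ℕ} (hn : 1 ≤ n) (c : ℝ) {u : EuclideanSpace ℝ (Fin n) → ℝ}
    (hu : ContDiff ℝ 2 u) (hs : HasCompactSupport u)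
    (h0 : (0 : EuclideanSpace ℝ (Fin n)) ∉ tsupport u)
    (hr : ∃ f : ℝ → ℝ, ∀ x : EuclideanSpace ℝ (Fin n), x ≠ 0 → u x = f ‖x‖) :
    ∃ h : ℝ → ℝ, ContDiff ℝ 2 h ∧ HasCompactSupport h ∧
      ∀ x, x ≠ 0 → u x = exp (-c * log ‖x‖) * h (log ‖x‖) := by
  obtain ⟨f, hf⟩ := hr
  let e : EuclideanSpace ℝ (Fin n) := EuclideanSpace.single ⟨0, hn⟩ 1
  have he : ‖e‖ = 1 := by simp [e]
  have hnorm (t : ℝ) : ‖exp t • e‖ = exp t := by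
    rw [norm_smul, he, mul_one, norm_of_nonneg (exp_pos t).le]
  obtain ⟨R, hR, hout⟩ := hs.exists_pos_le_norm
  obtain ⟨ρ, hρ, hin⟩ := Metric.eventually_nhds_iff.1 (notMem_tsupport_iff_eventuallyEq.1 h0)
  refine ⟨fun t => exp (c * t) * u (exp t • e), ?_, ?_, fun x hx => ?_⟩
  · exact (contDiff_const.mul contDiff_id).exp.mul (hu.comp (contDiff_exp.smul contDiff_const))
  · refine HasCompactSupport.intro (isCompact_Icc (a := log ρ) (b := log R)) fun t ht => ?_
    rw [mul_eq_zero]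
    right
    rw [mem_Icc, not_and_or, not_le, not_le] at ht
    rcases ht with ht | ht
    · refine hin ?_
      rw [dist_zero_right, hnorm]
      exact (lt_log_iff_exp_lt hρ).1 ht
    · refine hout _ ?_
      rw [hnorm]
      exact ((log_lt_iff_lt_exp hR).1 ht).le
  · have hx' : 0 < ‖x‖ := norm_pos_iff.2 hx
    have hne : ‖x‖ • e ≠ 0 := by
      rw [← norm_ne_zero_iff, norm_smul, he, norm_norm, mul_one]
      exact hx'.ne'
    beta_reduce
    rw [exp_log hx', hf x hx, hf _ hne, norm_smul, he, norm_norm, mul_one, ← mul_assoc, ← exp_add]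
    simp

/-- Every compactly supported profile in the variable `log ‖x‖` comes from a radial function
supported away from the origin. -/
theorem exists_radial_of_profile (n : ℕ) (c : ℝ) {h : ℝ → ℝ} (hh : ContDiff ℝ 2 h)
    (hs : HasCompactSupport h) :
    ∃ u : EuclideanSpace ℝ (Fin n) → ℝ, ContDiff ℝ 2 u ∧ HasCompactSupport u ∧
      (0 : EuclideanSpace ℝ (Fin n)) ∉ tsupport u ∧
      ∀ x, x ≠ 0 → u x = exp (-c * log ‖x‖) * h (log ‖x‖) := by
  classical
  obtain ⟨R, -, hout⟩ := hs.exists_pos_le_norm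
  let u : EuclideanSpace ℝ (Fin n) → ℝ :=
    fun x => if x = 0 then 0 else exp (-c * log ‖x‖) * h (log ‖x‖)
  have hu (x) (hx : x ≠ 0) : u x = exp (-c * log ‖x‖) * h (log ‖x‖) := if_neg hx
  have hzero : u =ᶠ[nhds 0] 0 := by
    filter_upwards [Metric.ball_mem_nhds 0 (exp_pos (-R))] with x hx
    rw [mem_ball_zero_iff] at hx
    by_cases hx0 : x = 0
    · exact if_pos hx0
    · have hlog := (log_lt_iff_lt_exp (norm_pos_iff.2 hx0)).2 hx
      rw [hu x hx0, hout _ (le_abs.2 (Or.inr (by linarith)))]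
      simp
  refine ⟨u, contDiff_iff_contDiffAt.2 fun x => ?_, ?_, notMem_tsupport_iff_eventuallyEq.2 hzero, hu⟩
  · by_cases hx : x = 0
    · subst hx
      exact (contDiffAt_const (c := (0 : ℝ))).congr_of_eventuallyEq hzero
    · have hlog : ContDiffAt ℝ 2 (fun y : EuclideanSpace ℝ (Fin n) => log ‖y‖) x :=
        (contDiffAt_norm ℝ hx).log (norm_ne_zero_iff.2 hx)
      have hprod := (contDiffAt_const (c := -c)).mul hlog |>.exp.mul (hh.contDiffAt.comp x hlog)
      refine hprod.congr_of_eventuallyEq ?_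
      filter_upwards [isOpen_ne.mem_nhds hx] with y hy using hu y hy
  · refine HasCompactSupport.intro (isCompact_closedBall 0 (exp R)) fun x hx => ?_
    rw [mem_closedBall_zero_iff, not_le] at hx
    have hpos : 0 < ‖x‖ := (exp_pos R).trans hx
    have hlog := (lt_log_iff_exp_lt hpos).2 hx
    rw [hu x (norm_pos_iff.1 hpos), hout _ (le_abs.2 (Or.inl hlog.le)), mul_zero]

theorem exists_slowly_varying {δ : ℝ} (hδ : 0 < δ) :
    ∃ h : ℝ → ℝ, ContDiff ℝ 2 h ∧ HasCompactSupport h ∧ 0 < ∫ t, deriv h t ^ 2 ∧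
      ∫ t, deriv h t ^ 2 ≤ δ * ∫ t, h t ^ 2 ∧
      ∫ t, deriv (deriv h) t ^ 2 ≤ δ * ∫ t, deriv h t ^ 2 := by
  let ψ : ContDiffBump (0 : ℝ) := ⟨1, 2, one_pos, one_lt_two⟩
  have hψ : ContDiff ℝ 2 ψ := ψ.contDiff (n := 2)
  have hs : HasCompactSupport ψ := ψ.hasCompactSupport
  have hψ0 : ψ 0 = 1 := ψ.one_of_mem_closedBall (by simp [ψ])
  have hpos {f : ℝ → ℝ} (hf : Continuous f) (hfs : HasCompactSupport f) {t : ℝ} (ht : f t ≠ 0) :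
      0 < ∫ t, f t ^ 2 := by
    simp only [sq]
    exact (hf.mul hf).integral_pos_of_hasCompactSupport_nonneg_nonzero (hfs.mul_left (f := f))
      (fun t => mul_self_nonneg (f t)) (mul_self_ne_zero.2 ht)
  obtain ⟨t₁, ht₁⟩ : ∃ t, deriv ψ t ≠ 0 := by
    by_contra! hall
    obtain ⟨R, -, hR⟩ := hs.exists_pos_le_norm
    have := is_const_of_deriv_eq_zero (hψ.differentiable (by norm_num)) hall 0 R
    rw [hψ0, hR R (le_abs_self R)] at this
    exact one_ne_zero this
  have hJ0 : 0 < ∫ t, ψ t ^ 2 := hpos hψ.continuous hs (t := 0) (by simp [hψ0])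
  have hJ1 : 0 < ∫ t, deriv ψ t ^ 2 :=
    hpos (hψ.continuous_deriv (by norm_num)) hs.deriv ht₁
  have hJ2 : 0 ≤ ∫ t, deriv (deriv ψ) t ^ 2 := integral_nonneg fun t => sq_nonneg _
  set J0 := ∫ t, ψ t ^ 2
  set J1 := ∫ t, deriv ψ t ^ 2
  set J2 := ∫ t, deriv (deriv ψ) t ^ 2
  obtain ⟨ε, hε, hε1, hε2⟩ : ∃ ε : ℝ, 0 < ε ∧ ε ^ 2 * J1 ≤ δ * J0 ∧ ε ^ 2 * J2 ≤ δ * J1 := by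
    have hC : 0 < J1 / J0 + J2 / J1 := by positivity
    refine ⟨√(δ / (J1 / J0 + J2 / J1)), by positivity, ?_⟩
    rw [sq_sqrt (by positivity), div_mul_eq_mul_div, div_mul_eq_mul_div, div_le_iff₀ hC,
      div_le_iff₀ hC, mul_assoc, mul_assoc]
    constructor
    · gcongr
      rw [mul_add, mul_div_cancel₀ _ hJ0.ne']
      exact le_add_of_nonneg_right (by positivity)
    · gcongr
      rw [mul_add, mul_div_cancel₀ _ hJ1.ne']
      exact le_add_of_nonneg_left (by positivity)
  have hd1 : deriv (fun t => ψ (ε * t)) = fun t => ε * deriv ψ (ε * t) := by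
    ext t
    exact deriv_comp_mul_left ε ψ t
  have hd2 : deriv (fun t => ε * deriv ψ (ε * t)) = fun t => ε ^ 2 * deriv (deriv ψ) (ε * t) := by
    ext t
    rw [deriv_const_mul_field, deriv_comp_mul_left ε (deriv ψ) t, smul_eq_mul]
    ring
  have hI0 : ∫ t, ψ (ε * t) ^ 2 = ε⁻¹ * J0 := by
    rw [Measure.integral_comp_mul_left (fun t => ψ t ^ 2) ε, abs_of_pos (inv_pos.2 hε), smul_eq_mul]
  have hI1 : ∫ t, (ε * deriv ψ (ε * t)) ^ 2 = ε⁻¹ * (ε ^ 2 * J1) := by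
    simp only [mul_pow]
    rw [integral_const_mul, Measure.integral_comp_mul_left (fun t => deriv ψ t ^ 2) ε,
      abs_of_pos (inv_pos.2 hε), smul_eq_mul]
    ring
  have hI2 : ∫ t, (ε ^ 2 * deriv (deriv ψ) (ε * t)) ^ 2 = ε⁻¹ * (ε ^ 2 * (ε ^ 2 * J2)) := by
    simp only [mul_pow]
    rw [integral_const_mul, Measure.integral_comp_mul_left (fun t => deriv (deriv ψ) t ^ 2) ε,
      abs_of_pos (inv_pos.2 hε), smul_eq_mul]
    ring
  refine ⟨fun t => ψ (ε * t), hψ.comp (contDiff_const.mul contDiff_id),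
    hs.comp_homeomorph (Homeomorph.mulLeft₀ ε hε.ne'), ?_⟩
  rw [hd1, hd2, hI0, hI1, hI2]
  refine ⟨by positivity, ?_, ?_⟩
  · rw [mul_left_comm δ]
    gcongr
  · rw [mul_left_comm δ, mul_left_comm δ]
    gcongr

theorem statement0 (n : ℕ) (hn : 2 ≤ n) (α : ℝ) :
    sInf {r : ℝ | ∃ u : EuclideanSpace ℝ (Fin n) → ℝ,
        ContDiff ℝ 2 u ∧ HasCompactSupport u ∧
        (0 : EuclideanSpace ℝ (Fin n)) ∉ tsupport u ∧
        (∃ f : ℝ → ℝ, ∀ x : EuclideanSpace ℝ (Fin n), x ≠ 0 → u x = f ‖x‖) ∧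
        (∫ x : EuclideanSpace ℝ (Fin n), ‖x‖ ^ (α - 2) * ‖gradient u x‖ ^ 2) ≠ 0 ∧
        r = (∫ x : EuclideanSpace ℝ (Fin n), ‖x‖ ^ α * (lap u x) ^ 2) /
            (∫ x : EuclideanSpace ℝ (Fin n), ‖x‖ ^ (α - 2) * ‖gradient u x‖ ^ 2)} =
      (((n : ℝ) - α) / 2) ^ 2 := by
  have hn1 : 1 ≤ n := one_le_two.trans hn
  obtain ⟨c, hc⟩ : ∃ c : ℝ, 2 * c = n + α - 4 := ⟨(n + α - 4) / 2, by ring⟩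
  have hK : 0 < n * volume.real (Metric.ball (0 : EuclideanSpace ℝ (Fin n)) 1) :=
    mul_pos (by exact_mod_cast hn1)
      (ENNReal.toReal_pos (Metric.measure_ball_pos _ _ one_pos).ne' measure_ball_lt_top.ne)
  have key : ∀ δ > 0, ∃ r ∈ {r : ℝ | ∃ u : EuclideanSpace ℝ (Fin n) → ℝ,
        ContDiff ℝ 2 u ∧ HasCompactSupport u ∧
        (0 : EuclideanSpace ℝ (Fin n)) ∉ tsupport u ∧
        (∃ f : ℝ → ℝ, ∀ x : EuclideanSpace ℝ (Fin n), x ≠ 0 → u x = f ‖x‖) ∧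
        (∫ x : EuclideanSpace ℝ (Fin n), ‖x‖ ^ (α - 2) * ‖gradient u x‖ ^ 2) ≠ 0 ∧
        r = (∫ x : EuclideanSpace ℝ (Fin n), ‖x‖ ^ α * (lap u x) ^ 2) /
            (∫ x : EuclideanSpace ℝ (Fin n), ‖x‖ ^ (α - 2) * ‖gradient u x‖ ^ 2)},
      r ≤ δ + (((n : ℝ) - α) / 2) ^ 2 := by
    intro δ hδ
    obtain ⟨h, hh, hs, hpos, h1, h2⟩ := exists_slowly_varying hδ
    obtain ⟨u, hu, hus, hu0, hur⟩ := exists_radial_of_profile n c hh hs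
    obtain ⟨hB, hA⟩ := integrals_of_profile hn1 hc hh hs hur
    have hden : 0 < (∫ t, deriv h t ^ 2) + c ^ 2 * ∫ t, h t ^ 2 :=
      add_pos_of_pos_of_nonneg hpos
        (mul_nonneg (sq_nonneg c) (integral_nonneg fun t => sq_nonneg _))
    refine ⟨_, ⟨u, hu, hus, hu0, ⟨fun r => exp (-c * log r) * h (log r), hur⟩, ?_, rfl⟩, ?_⟩
    · rw [hB]
      exact (mul_pos hK hden).ne'
    · rw [hA, hB, mul_div_mul_left _ _ hK.ne', div_le_iff₀ hden, add_mul]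
      gcongr
      rw [mul_add, mul_left_comm δ]
      gcongr
  refine csInf_eq_of_forall_ge_of_forall_gt_exists_lt ?_ ?_ ?_
  · obtain ⟨r, hr, -⟩ := key 1 one_pos
    exact ⟨r, hr⟩
  · rintro _ ⟨u, hu, hus, hu0, hur, hne, rfl⟩
    obtain ⟨h, hh, hs, hprofile⟩ := exists_profile hn1 c hu hus hu0 hur
    obtain ⟨hB, hA⟩ := integrals_of_profile hn1 hc hh hs hprofile
    have hI (f : ℝ → ℝ) : 0 ≤ ∫ t, f t ^ 2 := integral_nonneg fun t => sq_nonneg _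
    have hden : 0 < (∫ t, deriv h t ^ 2) + c ^ 2 * ∫ t, h t ^ 2 := by
      refine lt_of_le_of_ne (add_nonneg (hI _) (mul_nonneg (sq_nonneg c) (hI _))) fun h0 => hne ?_
      rw [hB, ← h0, mul_zero]
    rw [hA, hB, mul_div_mul_left _ _ hK.ne', le_div_iff₀ hden]
    exact le_add_of_nonneg_left (add_nonneg (hI _) (mul_nonneg (sq_nonneg c) (hI _)))
  · intro w hw
    obtain ⟨r, hr, hle⟩ := key ((w - (((n : ℝ) - α) / 2) ^ 2) / 2) (by linarith)
    exact ⟨r, hr, by linarith⟩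
end

section
/- Let n ≥ 2 be an integer. For every function u : ℝⁿ → ℝ of class C² with compact support contained in ℝⁿ \ {0}, one has ∫_{ℝⁿ} |x|^{4-n} |Δu(x)|² dx ≥ min{(n-2)², n-1} · ∫_{ℝⁿ} |x|^{2-n} |∇u(x)|² dx. -/
open MeasureTheory

open scoped ContDiff

/-- The partial derivative of `f` in the `i`-th coordinate direction. -/
noncomputable def partialDeriv {n : ℕ} (i : Fin n) (f : EuclideanSpace ℝ (Fin n) → ℝ)
    (x : EuclideanSpace ℝ (Fin n)) : ℝ :=
  fderiv ℝ f x (EuclideanSpace.single i 1)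

/-- Functions of class `C^k` vanishing outside `K`. -/
structure SmoothVanishingOff {n : ℕ} (K : Set (EuclideanSpace ℝ (Fin n))) (k : ℕ∞ω)
    (f : EuclideanSpace ℝ (Fin n) → ℝ) : Prop where
  contDiff : ContDiff ℝ k f
  eq_zero : ∀ x ∉ K, f x = 0

section Calculus

variable {n : ℕ} {x : EuclideanSpace ℝ (Fin n)} {f g : EuclideanSpace ℝ (Fin n) → ℝ}

theorem partialDeriv_add (i : Fin n) (hf : DifferentiableAt ℝ f x) (hg : DifferentiableAt ℝ g x) :
    partialDeriv i (fun y => f y + g y) x = partialDeriv i f x + partialDeriv i g x := by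
  simp [partialDeriv, fderiv_fun_add hf hg]

theorem partialDeriv_mul (i : Fin n) (hf : DifferentiableAt ℝ f x) (hg : DifferentiableAt ℝ g x) :
    partialDeriv i (fun y => f y * g y) x
      = f x * partialDeriv i g x + g x * partialDeriv i f x := by
  simp [partialDeriv, fderiv_fun_mul hf hg]

theorem partialDeriv_const_mul (i : Fin n) (c : ℝ) (hf : DifferentiableAt ℝ f x) :
    partialDeriv i (fun y => c * f y) x = c * partialDeriv i f x := by
  simp [partialDeriv, fderiv_const_mul hf]

theorem partialDeriv_sum {ι : Type*} (s : Finset ι) (i : Fin n)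
    {F : ι → EuclideanSpace ℝ (Fin n) → ℝ} (hF : ∀ j ∈ s, DifferentiableAt ℝ (F j) x) :
    partialDeriv i (fun y => ∑ j ∈ s, F j y) x = ∑ j ∈ s, partialDeriv i (F j) x := by
  simp [partialDeriv, fderiv_fun_sum hF]

theorem partialDeriv_coord (i j : Fin n) :
    partialDeriv i (fun y : EuclideanSpace ℝ (Fin n) => y j) x = if j = i then 1 else 0 := by
  have h : HasFDerivAt (fun y : EuclideanSpace ℝ (Fin n) => y j)
      (EuclideanSpace.proj (𝕜 := ℝ) j) x :=
    (EuclideanSpace.proj (𝕜 := ℝ) j : EuclideanSpace ℝ (Fin n) →L[ℝ] ℝ).hasFDerivAt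
  simp [partialDeriv, h.fderiv]

theorem differentiableAt_norm_rpow (hx : x ≠ 0) (a : ℝ) :
    DifferentiableAt ℝ (fun y : EuclideanSpace ℝ (Fin n) => ‖y‖ ^ a) x :=
  (differentiableAt_id.norm ℝ hx).rpow_const (Or.inl (norm_ne_zero_iff.2 hx))

theorem partialDeriv_norm_rpow (i : Fin n) (hx : x ≠ 0) (a : ℝ) :
    partialDeriv i (fun y => ‖y‖ ^ a) x = a * ‖x‖ ^ (a - 2) * x i := by
  have hn : 0 < ‖x‖ := norm_pos_iff.2 hx
  have h := ((hasStrictFDerivAt_norm_sq x).hasFDerivAt).rpow_const (p := a / 2)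
    (Or.inl (by positivity))
  have he : (fun y : EuclideanSpace ℝ (Fin n) => (‖y‖ ^ 2) ^ (a / 2)) = fun y => ‖y‖ ^ a := by
    funext y
    rw [← Real.rpow_natCast, ← Real.rpow_mul (norm_nonneg y)]
    congr 1; push_cast; ring
  rw [he] at h
  have h2 : (‖x‖ ^ 2) ^ (a / 2 - 1) = ‖x‖ ^ (a - 2) := by
    rw [← Real.rpow_natCast, ← Real.rpow_mul (norm_nonneg x)]
    congr 1; push_cast; ring
  simp only [partialDeriv, h.fderiv, h2]
  simp [EuclideanSpace.inner_single_right]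
  ring

theorem partialDeriv_norm_rpow_mul (i : Fin n) (hx : x ≠ 0) (a : ℝ) (hf : DifferentiableAt ℝ f x) :
    partialDeriv i (fun y => ‖y‖ ^ a * f y) x
      = a * ‖x‖ ^ (a - 2) * x i * f x + ‖x‖ ^ a * partialDeriv i f x := by
  rw [partialDeriv_mul i (differentiableAt_norm_rpow hx a) hf, partialDeriv_norm_rpow i hx]
  ring

theorem partialDeriv_comm (hf : ContDiff ℝ 2 f) (i j : Fin n) :
    partialDeriv i (partialDeriv j f) x = partialDeriv j (partialDeriv i f) x := by
  have hd : DifferentiableAt ℝ (fderiv ℝ f) x :=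
    (hf.fderiv_right (m := 1) (by norm_num)).differentiable (by norm_num) x
  have hs : IsSymmSndFDerivAt ℝ f x := hf.contDiffAt.isSymmSndFDerivAt (by simp)
  have h (k l : Fin n) : partialDeriv k (partialDeriv l f) x
      = fderiv ℝ (fderiv ℝ f) x (EuclideanSpace.single k 1) (EuclideanSpace.single l 1) := by
    change fderiv ℝ (fun y => fderiv ℝ f y (EuclideanSpace.single l 1)) x _ = _
    rw [fderiv_clm_apply hd (by fun_prop)]
    simp
  rw [h, h]
  exact hs _ _

theorem lap_eq_sum_partialDeriv (hf : ContDiff ℝ 2 f) :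
    lap f x = ∑ i, partialDeriv i (partialDeriv i f) x := by
  have hd : DifferentiableAt ℝ (fderiv ℝ f) x :=
    (hf.fderiv_right (m := 1) (by norm_num)).differentiable (by norm_num) x
  refine Finset.sum_congr rfl fun i _ => ?_
  change _ = fderiv ℝ (fun y => fderiv ℝ f y (EuclideanSpace.single i 1)) x _
  rw [iteratedFDeriv_two_apply, fderiv_clm_apply hd (by fun_prop)]
  simp

theorem norm_gradient_sq : ‖gradient f x‖ ^ 2 = ∑ i, partialDeriv i f x ^ 2 := by
  rw [EuclideanSpace.norm_sq_eq]
  refine Finset.sum_congr rfl fun i _ => ?_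
  have h : gradient f x i = partialDeriv i f x := by
    have := InnerProductSpace.toDual_symm_apply (𝕜 := ℝ) (x := EuclideanSpace.single i (1 : ℝ))
      (y := fderiv ℝ f x)
    rw [EuclideanSpace.inner_single_right] at this
    simpa [gradient, partialDeriv] using this
  rw [h, Real.norm_eq_abs, sq_abs]

theorem contDiff_partialDeriv {k l : ℕ∞ω} (hf : ContDiff ℝ l f) (hkl : k + 1 ≤ l) (i : Fin n) :
    ContDiff ℝ k (partialDeriv i f) :=
  (hf.fderiv_right hkl).clm_apply contDiff_const

end Calculus

namespace SmoothVanishingOff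

variable {n : ℕ} {K : Set (EuclideanSpace ℝ (Fin n))} {k : ℕ∞ω}
  {f g : EuclideanSpace ℝ (Fin n) → ℝ}

theorem hasCompactSupport (hf : SmoothVanishingOff K k f) (hK : IsCompact K) :
    HasCompactSupport f :=
  HasCompactSupport.intro hK hf.eq_zero

theorem integrable (hf : SmoothVanishingOff K k f) (hK : IsCompact K) : Integrable f :=
  hf.contDiff.continuous.integrable_of_hasCompactSupport (hf.hasCompactSupport hK)

theorem add (hf : SmoothVanishingOff K k f) (hg : SmoothVanishingOff K k g) :
    SmoothVanishingOff K k (fun x => f x + g x) :=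
  ⟨hf.contDiff.add hg.contDiff, fun x hx => by simp [hf.eq_zero x hx, hg.eq_zero x hx]⟩

theorem mul_left (hf : SmoothVanishingOff K k f) (hg : ContDiff ℝ k g) :
    SmoothVanishingOff K k (fun x => g x * f x) :=
  ⟨hg.mul hf.contDiff, fun x hx => by simp [hf.eq_zero x hx]⟩

theorem sum {ι : Type*} {s : Finset ι} {F : ι → EuclideanSpace ℝ (Fin n) → ℝ}
    (hF : ∀ i ∈ s, SmoothVanishingOff K k (F i)) :
    SmoothVanishingOff K k (fun x => ∑ i ∈ s, F i x) :=
  ⟨ContDiff.sum fun i hi => (hF i hi).contDiff,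
    fun x hx => Finset.sum_eq_zero fun i hi => (hF i hi).eq_zero x hx⟩

theorem partialDeriv {l : ℕ∞ω} (hf : SmoothVanishingOff K l f) (hK : IsClosed K) (hkl : k + 1 ≤ l)
    (i : Fin n) : SmoothVanishingOff K k (partialDeriv i f) := by
  refine ⟨contDiff_partialDeriv hf.contDiff hkl i, fun x hx => ?_⟩
  have h : f =ᶠ[nhds x] fun _ => 0 := by
    filter_upwards [hK.isOpen_compl.mem_nhds hx] with y hy using hf.eq_zero y hy
  simp [_root_.partialDeriv, h.fderiv_eq]

theorem norm_rpow_mul (hf : SmoothVanishingOff K k f) (hK : IsClosed K)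
    (h0 : (0 : EuclideanSpace ℝ (Fin n)) ∉ K) (a : ℝ) :
    SmoothVanishingOff K k (fun x => ‖x‖ ^ a * f x) := by
  refine ⟨contDiff_iff_contDiffAt.2 fun x => ?_, fun x hx => by simp [hf.eq_zero x hx]⟩
  by_cases hx : x = 0
  · have h : (fun x => ‖x‖ ^ a * f x) =ᶠ[nhds x] fun _ => 0 := by
      filter_upwards [hK.isOpen_compl.mem_nhds (hx ▸ h0)] with y hy
      simp [hf.eq_zero y hy]
    exact contDiffAt_const.congr_of_eventuallyEq h
  · exact ((contDiffAt_norm ℝ hx).rpow_const_of_ne (norm_ne_zero_iff.2 hx)).mul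
      hf.contDiff.contDiffAt

theorem integral_partialDeriv_eq_zero (hf : SmoothVanishingOff K 1 f) (hK : IsCompact K)
    (i : Fin n) : ∫ x, _root_.partialDeriv i f x = 0 := by
  obtain ⟨C, hC⟩ := hf.contDiff.lipschitzWith_of_hasCompactSupport (hf.hasCompactSupport hK)
    (by norm_num)
  have h := (LipschitzWith.const (1 : ℝ)).integral_lineDeriv_mul_eq (μ := volume) hC
    (hf.hasCompactSupport hK) (-EuclideanSpace.single i 1)
  have hd (x) : lineDeriv ℝ f x (EuclideanSpace.single i 1) = _root_.partialDeriv i f x :=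
    (hf.contDiff.differentiable (by norm_num) x).lineDeriv_eq_fderiv
  have hc (x v) : lineDeriv ℝ (fun _ : EuclideanSpace ℝ (Fin n) => (1 : ℝ)) x v = 0 := by
    simp [lineDeriv]
  simpa [hd, hc] using h.symm

/-- The mixed products `∂ᵢf ∂ⱼg` and `∂ⱼf ∂ᵢg` have the same integral, without assuming that `f` or
`g` has second derivatives. -/
theorem integral_partialDeriv_mul_comm (hf : SmoothVanishingOff K 1 f)
    (hg : SmoothVanishingOff K 1 g) (hK : IsCompact K) (i j : Fin n) :
    ∫ x, _root_.partialDeriv i f x * _root_.partialDeriv j g x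
      = ∫ x, _root_.partialDeriv j f x * _root_.partialDeriv i g x := by
  set v : EuclideanSpace ℝ (Fin n) := EuclideanSpace.single i 1
  obtain ⟨C, hC⟩ := hf.contDiff.lipschitzWith_of_hasCompactSupport (hf.hasCompactSupport hK)
    (by norm_num)
  obtain ⟨D, hD⟩ := hg.contDiff.lipschitzWith_of_hasCompactSupport (hg.hasCompactSupport hK)
    (by norm_num)
  have hfc := hf.hasCompactSupport hK
  have hgc := hg.hasCompactSupport hK
  have hf' := hf.partialDeriv hK.isClosed (k := 0) (by norm_num) j
  have hg' := hg.partialDeriv hK.isClosed (k := 0) (by norm_num) j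
  have hfd : Differentiable ℝ f := hf.contDiff.differentiable (by norm_num)
  have hgd : Differentiable ℝ g := hg.contDiff.differentiable (by norm_num)
  have A := hC.integral_inv_smul_sub_mul_tendsto_integral_lineDeriv_mul (μ := volume)
    (hg'.integrable hK) v
  have B := (hD.integral_inv_smul_sub_mul_tendsto_integral_lineDeriv_mul (μ := volume)
    (hf'.integrable hK) (-v)).neg
  have key (t : ℝ) : ∫ x, (t⁻¹ • (f (x + t • v) - f x)) * _root_.partialDeriv j g x
      = -∫ x, (t⁻¹ • (g (x + t • (-v)) - g x)) * _root_.partialDeriv j f x := by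
    have hgi (φ : EuclideanSpace ℝ (Fin n) → ℝ) (hφ : Continuous φ) :
        Integrable (fun x => φ x * g x) :=
      (hφ.mul hg.contDiff.continuous).integrable_of_hasCompactSupport hgc.mul_left
    have hFd : Differentiable ℝ fun x => t⁻¹ * (f (x + t • v) - f x) := by fun_prop
    have hF' (x) : fderiv ℝ (fun x => t⁻¹ * (f (x + t • v) - f x)) x (EuclideanSpace.single j 1)
        = t⁻¹ * (_root_.partialDeriv j f (x + t • v) - _root_.partialDeriv j f x) := by
      rw [fderiv_const_mul (by fun_prop), fderiv_fun_sub (by fun_prop) (by fun_prop),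
        fderiv_comp_add_right]
      rfl
    have hf'c : Continuous (_root_.partialDeriv j f) := hf'.contDiff.continuous
    have hfcont : Continuous f := hf.contDiff.continuous
    have hgcont : Continuous g := hg.contDiff.continuous
    have ibp := integral_mul_fderiv_eq_neg_fderiv_mul_of_integrable (μ := volume)
      (f := fun x => t⁻¹ * (f (x + t • v) - f x)) (g := g) (v := EuclideanSpace.single j 1)
      (by simp only [hF']; exact hgi _ (by fun_prop))
      (((by fun_prop : Continuous fun x => t⁻¹ * (f (x + t • v) - f x)).mul
        hg'.contDiff.continuous).integrable_of_hasCompactSupport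
        (hg'.hasCompactSupport hK).mul_left)
      (hgi _ (by fun_prop)) (fun x _ => hFd x) (fun x _ => hgd x)
    simp only [hF'] at ibp
    have shift : ∫ x, _root_.partialDeriv j f (x + t • v) * g x
        = ∫ x, _root_.partialDeriv j f x * g (x + t • (-v)) := by
      rw [← integral_add_right_eq_self (fun x => _root_.partialDeriv j f x * g (x + t • (-v)))
        (t • v)]
      simp
    have hi : Integrable fun x => _root_.partialDeriv j f x * g (x + t • (-v)) :=
      (by fun_prop : Continuous fun x => _root_.partialDeriv j f x * g (x + t • (-v)))
        |>.integrable_of_hasCompactSupport (hf'.hasCompactSupport hK).mul_right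
    refine ibp.trans ?_
    congr 1
    calc ∫ x, t⁻¹ * (_root_.partialDeriv j f (x + t • v) - _root_.partialDeriv j f x) * g x
        = t⁻¹ * ((∫ x, _root_.partialDeriv j f (x + t • v) * g x)
          - ∫ x, _root_.partialDeriv j f x * g x) := by
          rw [← integral_sub (hgi _ (by fun_prop)) (hgi _ hf'c), ← integral_const_mul]
          congr 1; ext x; ring
      _ = _ := by
          rw [shift, ← integral_sub hi (hgi _ hf'c), ← integral_const_mul]
          congr 1; ext x; simp only [smul_eq_mul]; ring
  simp only [key] at A
  have h := tendsto_nhds_unique A B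
  have hd1 (x) : lineDeriv ℝ f x v = _root_.partialDeriv i f x := (hfd x).lineDeriv_eq_fderiv
  have hd2 (x) : lineDeriv ℝ g x (-v) = -_root_.partialDeriv i g x := by
    rw [lineDeriv_neg, (hgd x).lineDeriv_eq_fderiv]
    rfl
  simp only [hd1, hd2] at h
  rw [h, ← integral_neg]
  congr 1; ext x; ring

end SmoothVanishingOff

section Algebra

theorem sq_sum_mul_trace_sub_le {ι : Type*} [Fintype ι] [DecidableEq ι] (x y : ι → ℝ)
    (H : ι → ι → ℝ) (hH : ∀ i j, H i j = H j i) (hy : ∀ i, ∑ j, H i j * x j = y i)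
    (hx : 0 < ∑ i, x i ^ 2) :
    ((∑ i, x i ^ 2) * ∑ i, H i i - ∑ i, x i * y i) ^ 2
      ≤ (Fintype.card ι - 1) * ((∑ i, x i ^ 2) ^ 2 * ∑ i, ∑ j, H i j ^ 2
        - 2 * (∑ i, x i ^ 2) * ∑ i, y i ^ 2 + (∑ i, x i * y i) ^ 2) := by
  set R := ∑ i, x i ^ 2 with hR
  set T := ∑ i, H i i with hT
  set q := ∑ i, x i * y i with hq
  set Y := ∑ i, y i ^ 2 with hY
  set S := ∑ i, ∑ j, H i j ^ 2 with hS
  -- `A` is `R²` times the compression of `H` to the orthogonal complement of `x`,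
  -- and `B` is `R` times the projection onto that complement.
  let A : ι × ι → ℝ := fun k =>
    R ^ 2 * H k.1 k.2 - R * (x k.1 * y k.2 + y k.1 * x k.2) + q * (x k.1 * x k.2)
  let B : ι × ι → ℝ := fun k => R * (if k.1 = k.2 then 1 else 0) - x k.1 * x k.2
  have hz : ∑ i, x i * ∑ j, H i j * y j = Y := by
    simp_rw [Finset.mul_sum]
    rw [Finset.sum_comm, hY]
    refine Finset.sum_congr rfl fun j _ => ?_
    rw [sq, ← hy j, Finset.mul_sum]
    refine Finset.sum_congr rfl fun i _ => ?_
    rw [hH i j, hy j]; ring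
  have hAA : ∑ k, A k ^ 2 = R ^ 2 * (R ^ 2 * S - 2 * R * Y + q ^ 2) := by
    rw [Fintype.sum_prod_type]
    have h (i : ι) : ∑ j, A (i, j) ^ 2 = R ^ 4 * ∑ j, H i j ^ 2 + R ^ 2 * Y * x i ^ 2
        + (2 * R ^ 2 * q + 2 * R ^ 2 * q - 2 * R ^ 2 * q) * (x i * y i)
        + (R ^ 3 - 2 * R ^ 3) * y i ^ 2 + (q ^ 2 * R - 2 * R * q ^ 2) * x i ^ 2
        - 2 * R ^ 3 * (x i * ∑ j, H i j * y j) := by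
      calc ∑ j, A (i, j) ^ 2 = ∑ j, (R ^ 4 * H i j ^ 2 + R ^ 2 * x i ^ 2 * y j ^ 2
            + (2 * R ^ 2 * (x i * y i) - 2 * R * q * x i ^ 2) * (x j * y j)
            + (R ^ 2 * y i ^ 2 + q ^ 2 * x i ^ 2 - 2 * R * q * (x i * y i)) * x j ^ 2
            + (- 2 * R ^ 3 * x i) * (H i j * y j)
            + (2 * R ^ 2 * q * x i - 2 * R ^ 3 * y i) * (H i j * x j)) := by
            refine Finset.sum_congr rfl fun j _ => ?_
            simp only [A]; ring
        _ = _ := by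
            simp only [Finset.sum_add_distrib, ← Finset.mul_sum, hy, ← hR, ← hq, ← hY]
            ring
    simp only [h, Finset.sum_add_distrib, Finset.sum_sub_distrib, ← Finset.mul_sum, hz, ← hR,
      ← hq, ← hY, ← hS]
    ring
  have hAx : ∑ i, ∑ j, A (i, j) * (x i * x j) = 0 := by
    have h (i : ι) : ∑ j, A (i, j) * (x i * x j)
        = R ^ 2 * (x i * y i) - R * q * x i ^ 2 - R ^ 2 * (x i * y i) + q * R * x i ^ 2 := by
      calc ∑ j, A (i, j) * (x i * x j) = ∑ j, (R ^ 2 * x i * (H i j * x j)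
            + (- R * x i ^ 2) * (x j * y j) + (- R * x i * y i + q * x i ^ 2) * x j ^ 2) := by
            refine Finset.sum_congr rfl fun j _ => ?_
            simp only [A]; ring
        _ = _ := by
            simp only [Finset.sum_add_distrib, ← Finset.mul_sum, hy, ← hR, ← hq]
            ring
    simp only [h, Finset.sum_add_distrib, Finset.sum_sub_distrib, ← Finset.mul_sum, ← hR, ← hq]
    ring
  have hAB : ∑ k, A k * B k = R ^ 2 * (R * T - q) := by
    rw [Fintype.sum_prod_type]
    have h (i : ι) : ∑ j, A (i, j) * B (i, j)
        = R * A (i, i) - ∑ j, A (i, j) * (x i * x j) := by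
      simp only [B, mul_sub, Finset.sum_sub_distrib, mul_ite, mul_one, mul_zero,
        Finset.sum_ite_eq, Finset.mem_univ, if_true]
      ring
    have h' : ∑ i, A (i, i) = ∑ i, (R ^ 2 * H i i - 2 * R * (x i * y i) + q * x i ^ 2) := by
      refine Finset.sum_congr rfl fun i _ => ?_
      simp only [A]; ring
    simp only [h, Finset.sum_sub_distrib, hAx, ← Finset.mul_sum, h', Finset.sum_add_distrib,
      ← hR, ← hq, ← hT]
    ring
  have hBB : ∑ k, B k ^ 2 = R ^ 2 * (Fintype.card ι - 1) := by
    rw [Fintype.sum_prod_type]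
    have h (i : ι) : ∑ j, B (i, j) ^ 2 = R ^ 2 - 2 * R * x i ^ 2 + R * x i ^ 2 := by
      calc ∑ j, B (i, j) ^ 2
          = ∑ j, ((if i = j then R ^ 2 - 2 * R * (x i * x j) else 0) + x i ^ 2 * x j ^ 2) := by
            refine Finset.sum_congr rfl fun j _ => ?_
            simp only [B]; split_ifs <;> ring
        _ = _ := by
            simp only [Finset.sum_add_distrib, ← Finset.mul_sum, Finset.sum_ite_eq,
              Finset.mem_univ, if_true, ← hR]
            ring
    simp only [h, Finset.sum_add_distrib, Finset.sum_sub_distrib, ← Finset.mul_sum, ← hR,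
      Finset.sum_const, Finset.card_univ, nsmul_eq_mul]
    ring
  have hcs := Finset.sum_mul_sq_le_sq_mul_sq Finset.univ A B
  rw [hAA, hAB, hBB] at hcs
  have hR4 : 0 < R ^ 4 := by positivity
  refine le_of_mul_le_mul_left ?_ hR4
  linarith

/-- Here `ν` plays the role of the dimension, and `R`, `p`, `q`, `G`, `a`, `Y`, `T`, `S` those of
`|x|²`, `x·∇u`, `x·Hx`, `|∇u|²`, `∇u·Hx`, `|Hx|²`, `Δu`, `|H|²`, where `H` is the Hessian of `u`.
The terms on the left are, up to a power of `|x|`, integrands with vanishing integral. -/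
theorem null_terms_le (ν R p q G a Y T S C : ℝ) (hν : 2 < ν)
    (hC₁ : C ≤ (ν - 2) ^ 2) (hC₂ : C ≤ ν - 1) (h₁ : p ^ 2 ≤ R * G)
    (h₂ : (p + q) ^ 2 ≤ R * (G + 2 * a + Y))
    (h₃ : (R * T - q) ^ 2 ≤ (ν - 1) * (R ^ 2 * S - 2 * R * Y + q ^ 2)) :
    4 * (p ^ 2 + p * q)
      - (ν + 1 + (ν ^ 2 - 5 * ν + 8) / (ν - 2)) * (R * (G + a))
      + (ν ^ 2 - 5 * ν + 8) / (ν - 2) * (R * (G + a + p * T) - (ν - 2) * p ^ 2)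
      + (ν - 1) / (ν - 2) * ((4 - ν) * R * (T * p - a) + R ^ 2 * (T ^ 2 - S))
      + -2 / (ν - 2) * ((2 - ν) * p * (R * T - q)
        + R * (T * p + T * q - a - Y + (ν - 1) * (p * T)))
      ≤ R ^ 2 * T ^ 2 - C * (R * G) := by
  have hN : 0 < ν - 2 := by linarith
  have hm : 0 < ν - 1 := by linarith
  have e₁ : 0 ≤ ((ν - 2) ^ 2 - C) * p ^ 2 := mul_nonneg (by linarith) (sq_nonneg p)
  have e₂ : 0 ≤ (ν - 1 - C) * (R * G - p ^ 2) := mul_nonneg (by linarith) (by linarith)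
  have e₃ : 0 ≤ (p + q) ^ 2 + 2 * (R * (G + 2 * a + Y) - (p + q) ^ 2) := by
    nlinarith [sq_nonneg (p + q)]
  have e₄ : 0 ≤ 1 / (ν - 2) * ((ν - 1) * (R ^ 2 * S - 2 * R * Y + q ^ 2) - (R * T - q) ^ 2) :=
    mul_nonneg (by positivity) (by linarith)
  rw [← sub_nonneg]
  refine (add_nonneg (add_nonneg e₁ e₂) (add_nonneg e₃ e₄)).trans_eq ?_
  field_simp
  ring

end Algebra

section Identities

variable {n : ℕ}

/-- The function `x · ∇u`. -/
noncomputable def radialDeriv (u : EuclideanSpace ℝ (Fin n) → ℝ)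
    (x : EuclideanSpace ℝ (Fin n)) : ℝ :=
  ∑ j, x j * partialDeriv j u x

/-- The function `|∇u|²`. -/
noncomputable def gradSq (u : EuclideanSpace ℝ (Fin n) → ℝ)
    (x : EuclideanSpace ℝ (Fin n)) : ℝ :=
  ∑ j, partialDeriv j u x ^ 2

/-- The vector field `|x|⁻ⁿ (2 (x·∇u)² x) + |x|²⁻ⁿ (b |∇u|² x + c (x·∇u) ∇u)`. -/
noncomputable def divField (b c : ℝ) (u : EuclideanSpace ℝ (Fin n) → ℝ) (i : Fin n)
    (x : EuclideanSpace ℝ (Fin n)) : ℝ :=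
  ‖x‖ ^ (-(n : ℝ)) * ((2 * radialDeriv u x) * (radialDeriv u x * x i))
    + ‖x‖ ^ (2 - (n : ℝ)) * (b * x i * gradSq u x + c * radialDeriv u x * partialDeriv i u x)

/-- The vector field `b |x|⁴⁻ⁿ ∇u + c |x|²⁻ⁿ (x·∇u) x`. -/
noncomputable def curlField (b c : ℝ) (u : EuclideanSpace ℝ (Fin n) → ℝ) (i : Fin n)
    (x : EuclideanSpace ℝ (Fin n)) : ℝ :=
  ‖x‖ ^ (4 - (n : ℝ)) * (b * partialDeriv i u x)
    + ‖x‖ ^ (2 - (n : ℝ)) * (c * x i * radialDeriv u x)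

variable {u : EuclideanSpace ℝ (Fin n) → ℝ} {x : EuclideanSpace ℝ (Fin n)}

theorem contDiff_coord {k : ℕ∞ω} (i : Fin n) :
    ContDiff ℝ k fun x : EuclideanSpace ℝ (Fin n) => x i :=
  (EuclideanSpace.proj (𝕜 := ℝ) i : EuclideanSpace ℝ (Fin n) →L[ℝ] ℝ).contDiff

theorem contDiff_radialDeriv (hu : ContDiff ℝ 2 u) : ContDiff ℝ 1 (radialDeriv u) :=
  ContDiff.sum fun j _ => (contDiff_coord j).mul (contDiff_partialDeriv hu (by norm_num) j)

theorem contDiff_gradSq (hu : ContDiff ℝ 2 u) : ContDiff ℝ 1 (gradSq u) :=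
  ContDiff.sum fun j _ => (contDiff_partialDeriv hu (by norm_num) j).pow 2

theorem partialDeriv_radialDeriv (hu : ContDiff ℝ 2 u) (i : Fin n) :
    partialDeriv i (radialDeriv u) x
      = partialDeriv i u x + ∑ j, partialDeriv i (partialDeriv j u) x * x j := by
  have hd (j : Fin n) : DifferentiableAt ℝ (partialDeriv j u) x :=
    (contDiff_partialDeriv hu (k := 1) (by norm_num) j).differentiable (by norm_num) x
  have hc (j : Fin n) : DifferentiableAt ℝ (fun y : EuclideanSpace ℝ (Fin n) => y j) x :=
    (contDiff_coord j (k := 1)).differentiable (by norm_num) x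
  have h := partialDeriv_sum (x := x) Finset.univ i
    (F := fun j y => y j * partialDeriv j u y) fun j _ => (hc j).mul (hd j)
  refine h.trans ?_
  simp only [partialDeriv_mul i (hc _) (hd _), partialDeriv_coord, Finset.sum_add_distrib,
    mul_ite, mul_one, mul_zero, Finset.sum_ite_eq', Finset.mem_univ, if_true]
  rw [add_comm]
  simp only [mul_comm]

theorem partialDeriv_gradSq (hu : ContDiff ℝ 2 u) (i : Fin n) :
    partialDeriv i (gradSq u) x
      = 2 * ∑ j, partialDeriv j u x * partialDeriv i (partialDeriv j u) x := by
  have hd (j : Fin n) : DifferentiableAt ℝ (partialDeriv j u) x :=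
    (contDiff_partialDeriv hu (k := 1) (by norm_num) j).differentiable (by norm_num) x
  have h := partialDeriv_sum (x := x) Finset.univ i
    (F := fun j y => partialDeriv j u y * partialDeriv j u y) fun j _ => (hd j).mul (hd j)
  have he : gradSq u = fun y => ∑ j, partialDeriv j u y * partialDeriv j u y := by
    funext y
    simp only [gradSq, sq]
  rw [he, h, Finset.mul_sum]
  refine Finset.sum_congr rfl fun j _ => ?_
  rw [partialDeriv_mul i (hd j) (hd j)]
  ring

theorem norm_rpow_add_two (hx : x ≠ 0) (a : ℝ) : ‖x‖ ^ (a + 2) = ‖x‖ ^ a * ‖x‖ ^ 2 := by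
  rw [Real.rpow_add (norm_pos_iff.2 hx), Real.rpow_two]

theorem sum_partialDeriv_divField (hu : ContDiff ℝ 2 u) (hx : x ≠ 0) (b c : ℝ) :
    ∑ i, partialDeriv i (divField b c u i) x = ‖x‖ ^ (-(n : ℝ)) *
      (4 * (radialDeriv u x ^ 2 + radialDeriv u x *
          ∑ i, x i * ∑ j, partialDeriv i (partialDeriv j u) x * x j)
        + 2 * b * (‖x‖ ^ 2 * (gradSq u x + ∑ i, partialDeriv i u x *
          ∑ j, partialDeriv i (partialDeriv j u) x * x j))
        + c * (‖x‖ ^ 2 * (gradSq u x + (∑ i, partialDeriv i u x *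
          ∑ j, partialDeriv i (partialDeriv j u) x * x j)
          + radialDeriv u x * ∑ i, partialDeriv i (partialDeriv i u) x)
          - (n - 2) * radialDeriv u x ^ 2)) := by
  set p := radialDeriv u x with hp
  set G := gradSq u x with hG
  set y : Fin n → ℝ := fun i => ∑ j, partialDeriv i (partialDeriv j u) x * x j with hy
  set ρ := ‖x‖ ^ (-(n : ℝ)) with hρ
  have hR : ‖x‖ ^ 2 = ∑ i, x i ^ 2 := EuclideanSpace.real_norm_sq_eq x
  have hρ2 : ‖x‖ ^ (2 - (n : ℝ)) = ρ * ‖x‖ ^ 2 := by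
    rw [← norm_rpow_add_two hx]; congr 1; ring
  have hρm : ‖x‖ ^ (-(n : ℝ) - 2) * ‖x‖ ^ 2 = ρ := by
    rw [← norm_rpow_add_two hx, hρ]; congr 1; ring
  have hρm' : ‖x‖ ^ (2 - (n : ℝ) - 2) = ρ := by
    rw [hρ]; congr 1; ring
  have hd (j : Fin n) : DifferentiableAt ℝ (partialDeriv j u) x :=
    (contDiff_partialDeriv hu (k := 1) (by norm_num) j).differentiable (by norm_num) x
  have hc (j : Fin n) : DifferentiableAt ℝ (fun y : EuclideanSpace ℝ (Fin n) => y j) x :=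
    (contDiff_coord j (k := 1)).differentiable (by norm_num) x
  have hpd : DifferentiableAt ℝ (radialDeriv u) x :=
    (contDiff_radialDeriv hu).differentiable (by norm_num) x
  have hGd : DifferentiableAt ℝ (gradSq u) x :=
    (contDiff_gradSq hu).differentiable (by norm_num) x
  have hz : ∑ i, x i * ∑ j, partialDeriv j u x * partialDeriv i (partialDeriv j u) x
      = ∑ i, partialDeriv i u x * y i := by
    simp only [hy, Finset.mul_sum]
    rw [Finset.sum_comm]
    refine Finset.sum_congr rfl fun i _ => Finset.sum_congr rfl fun j _ => ?_
    rw [partialDeriv_comm hu]; ring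
  have key (i : Fin n) : partialDeriv i (divField b c u i) x
      = (-(n : ℝ)) * (‖x‖ ^ (-(n : ℝ) - 2) * (2 * p ^ 2)) * x i ^ 2
        + (4 * ρ * p) * (x i * partialDeriv i u x) + 4 * ρ * p * (x i * y i) + 2 * ρ * p ^ 2
        + (2 - (n : ℝ)) * ρ * b * G * x i ^ 2
        + (2 - (n : ℝ)) * ρ * c * p * (x i * partialDeriv i u x)
        + 2 * b * ρ * ‖x‖ ^ 2 *
            (x i * ∑ j, partialDeriv j u x * partialDeriv i (partialDeriv j u) x)
        + ρ * ‖x‖ ^ 2 * b * G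
        + ρ * ‖x‖ ^ 2 * c * partialDeriv i u x ^ 2
        + ρ * ‖x‖ ^ 2 * c * (partialDeriv i u x * y i)
        + ρ * ‖x‖ ^ 2 * c * p * partialDeriv i (partialDeriv i u) x := by
    unfold divField
    have f₁ := hpd.const_mul 2
    have f₂ := hpd.fun_mul (hc i)
    have f₃ := (hc i).const_mul b
    have f₄ := hpd.const_mul c
    rw [partialDeriv_add i ((differentiableAt_norm_rpow hx _).fun_mul (f₁.fun_mul f₂))
        ((differentiableAt_norm_rpow hx _).fun_mul ((f₃.fun_mul hGd).fun_add (f₄.fun_mul (hd i)))),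
      partialDeriv_norm_rpow_mul i hx _ (f₁.fun_mul f₂),
      partialDeriv_norm_rpow_mul i hx _ ((f₃.fun_mul hGd).fun_add (f₄.fun_mul (hd i))),
      partialDeriv_add i (f₃.fun_mul hGd) (f₄.fun_mul (hd i)),
      partialDeriv_mul i f₁ f₂, partialDeriv_mul i hpd (hc i),
      partialDeriv_mul i f₃ hGd, partialDeriv_mul i f₄ (hd i),
      partialDeriv_const_mul i _ hpd, partialDeriv_const_mul i _ (hc i),
      partialDeriv_const_mul i _ hpd, partialDeriv_radialDeriv hu, partialDeriv_gradSq hu,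
      partialDeriv_coord, if_pos rfl, hρ2, hρm']
    simp only [← hp, ← hG, ← hρ]
    rw [show ∑ j, partialDeriv i (partialDeriv j u) x * x j = y i from rfl]
    ring
  have hpx : ∑ i, x i * partialDeriv i u x = p := rfl
  have hGx : ∑ i, partialDeriv i u x ^ 2 = G := rfl
  simp only [key, Finset.sum_add_distrib, ← Finset.mul_sum, hz, ← hR, hpx, hGx, Finset.sum_const,
    Finset.card_univ, Fintype.card_fin, nsmul_eq_mul]
  linear_combination (-(n : ℝ)) * (2 * p ^ 2) * hρm

theorem sum_curl_curlField (hu : ContDiff ℝ 2 u) (hx : x ≠ 0) (b c : ℝ) :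
    ∑ i, ∑ j, (partialDeriv i (curlField b c u i) x * partialDeriv j (partialDeriv j u) x
        - partialDeriv j (curlField b c u i) x * partialDeriv i (partialDeriv j u) x)
      = ‖x‖ ^ (-(n : ℝ)) *
      (b * ((4 - n) * ‖x‖ ^ 2 * ((∑ i, partialDeriv i (partialDeriv i u) x) * radialDeriv u x
          - ∑ i, partialDeriv i u x * ∑ j, partialDeriv i (partialDeriv j u) x * x j)
          + (‖x‖ ^ 2) ^ 2 * ((∑ i, partialDeriv i (partialDeriv i u) x) ^ 2
            - ∑ i, ∑ j, partialDeriv i (partialDeriv j u) x ^ 2))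
        + c * ((2 - n) * radialDeriv u x * (‖x‖ ^ 2 * (∑ i, partialDeriv i (partialDeriv i u) x)
            - ∑ i, x i * ∑ j, partialDeriv i (partialDeriv j u) x * x j)
          + ‖x‖ ^ 2 * ((∑ i, partialDeriv i (partialDeriv i u) x) * radialDeriv u x
            + (∑ i, partialDeriv i (partialDeriv i u) x) *
              (∑ i, x i * ∑ j, partialDeriv i (partialDeriv j u) x * x j)
            - (∑ i, partialDeriv i u x * ∑ j, partialDeriv i (partialDeriv j u) x * x j)
            - (∑ i, (∑ j, partialDeriv i (partialDeriv j u) x * x j) ^ 2)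
            + (n - 1) * (radialDeriv u x * ∑ i, partialDeriv i (partialDeriv i u) x)))) := by
  set p := radialDeriv u x with hp
  set y : Fin n → ℝ := fun i => ∑ j, partialDeriv i (partialDeriv j u) x * x j with hy
  set ρ := ‖x‖ ^ (-(n : ℝ)) with hρ
  set T := ∑ i, partialDeriv i (partialDeriv i u) x with hT
  have hR : ‖x‖ ^ 2 = ∑ i, x i ^ 2 := EuclideanSpace.real_norm_sq_eq x
  have hρ2 : ‖x‖ ^ (2 - (n : ℝ)) = ρ * ‖x‖ ^ 2 := by
    rw [← norm_rpow_add_two hx]; congr 1; ring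
  have hρ4' : ‖x‖ ^ (4 - (n : ℝ) - 2) = ρ * ‖x‖ ^ 2 := by
    rw [← norm_rpow_add_two hx]; congr 1; ring
  have hρ4 : ‖x‖ ^ (4 - (n : ℝ)) = ρ * (‖x‖ ^ 2) ^ 2 := by
    rw [sq (‖x‖ ^ 2), ← mul_assoc, ← norm_rpow_add_two hx, ← norm_rpow_add_two hx]
    congr 1; ring
  have hρm' : ‖x‖ ^ (2 - (n : ℝ) - 2) = ρ := by
    rw [hρ]; congr 1; ring
  have hd (j : Fin n) : DifferentiableAt ℝ (partialDeriv j u) x :=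
    (contDiff_partialDeriv hu (k := 1) (by norm_num) j).differentiable (by norm_num) x
  have hc (j : Fin n) : DifferentiableAt ℝ (fun y : EuclideanSpace ℝ (Fin n) => y j) x :=
    (contDiff_coord j (k := 1)).differentiable (by norm_num) x
  have hpd : DifferentiableAt ℝ (radialDeriv u) x :=
    (contDiff_radialDeriv hu).differentiable (by norm_num) x
  have key (i j : Fin n) : partialDeriv j (curlField b c u i) x
      = ((4 - (n : ℝ)) * ρ * ‖x‖ ^ 2 * b * partialDeriv i u x) * x j
        + ρ * (‖x‖ ^ 2) ^ 2 * b * partialDeriv i (partialDeriv j u) x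
        + ((2 - (n : ℝ)) * ρ * c * p * x i) * x j
        + (ρ * ‖x‖ ^ 2 * c * x i) * partialDeriv j u x
        + (ρ * ‖x‖ ^ 2 * c * x i) * y j
        + (if i = j then ρ * ‖x‖ ^ 2 * c * p else 0) := by
    unfold curlField
    have f₁ := (hd i).const_mul b
    have f₂ := (hc i).const_mul c
    rw [partialDeriv_add j ((differentiableAt_norm_rpow hx _).fun_mul f₁)
        ((differentiableAt_norm_rpow hx _).fun_mul (f₂.fun_mul hpd)),
      partialDeriv_norm_rpow_mul j hx _ f₁, partialDeriv_norm_rpow_mul j hx _ (f₂.fun_mul hpd),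
      partialDeriv_mul j f₂ hpd, partialDeriv_const_mul j _ (hd i),
      partialDeriv_const_mul j _ (hc i), partialDeriv_radialDeriv hu,
      partialDeriv_coord, partialDeriv_comm hu j i, hρ2, hρm', hρ4, hρ4']
    simp only [← hp]
    rw [show ∑ k, partialDeriv j (partialDeriv k u) x * x k = y j from rfl]
    split_ifs <;> ring
  have hyx (i : Fin n) : ∑ j, partialDeriv i (partialDeriv j u) x * x j = y i := rfl
  have hpx : ∑ i, x i * partialDeriv i u x = p := rfl
  have hgH : ∑ i, x i * ∑ j, partialDeriv i (partialDeriv j u) x * partialDeriv j u x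
      = ∑ i, partialDeriv i u x * y i := by
    simp only [hy, Finset.mul_sum]
    rw [Finset.sum_comm]
    refine Finset.sum_congr rfl fun i _ => Finset.sum_congr rfl fun j _ => ?_
    rw [partialDeriv_comm hu]; ring
  have hyH : ∑ i, x i * ∑ j, partialDeriv i (partialDeriv j u) x * y j = ∑ i, y i ^ 2 := by
    simp only [Finset.mul_sum]
    rw [Finset.sum_comm]
    refine Finset.sum_congr rfl fun j _ => ?_
    rw [sq]
    nth_rewrite 2 [hy]
    rw [Finset.mul_sum]
    refine Finset.sum_congr rfl fun i _ => ?_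
    rw [partialDeriv_comm hu]; ring
  have hdiag : ∑ i, partialDeriv i (curlField b c u i) x
      = (4 - (n : ℝ)) * ρ * ‖x‖ ^ 2 * b * p + ρ * (‖x‖ ^ 2) ^ 2 * b * T
        + (2 - (n : ℝ)) * ρ * c * p * ‖x‖ ^ 2 + ρ * ‖x‖ ^ 2 * c * p
        + ρ * ‖x‖ ^ 2 * c * ∑ i, x i * y i + n * (ρ * ‖x‖ ^ 2 * c * p) := by
    calc ∑ i, partialDeriv i (curlField b c u i) x
        = ∑ i, ((4 - (n : ℝ)) * ρ * ‖x‖ ^ 2 * b * (x i * partialDeriv i u x)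
          + ρ * (‖x‖ ^ 2) ^ 2 * b * partialDeriv i (partialDeriv i u) x
          + (2 - (n : ℝ)) * ρ * c * p * x i ^ 2
          + ρ * ‖x‖ ^ 2 * c * (x i * partialDeriv i u x)
          + ρ * ‖x‖ ^ 2 * c * (x i * y i) + ρ * ‖x‖ ^ 2 * c * p) := by
          refine Finset.sum_congr rfl fun i _ => ?_
          rw [key, if_pos rfl]; ring
      _ = _ := by
          simp only [Finset.sum_add_distrib, ← Finset.mul_sum, hpx, ← hR, ← hT, Finset.sum_const,
            Finset.card_univ, Fintype.card_fin, nsmul_eq_mul]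
          ring
  have hoff (i : Fin n) :
      ∑ j, partialDeriv j (curlField b c u i) x * partialDeriv i (partialDeriv j u) x
        = (4 - (n : ℝ)) * ρ * ‖x‖ ^ 2 * b * (partialDeriv i u x * y i)
          + ρ * (‖x‖ ^ 2) ^ 2 * b * ∑ j, partialDeriv i (partialDeriv j u) x ^ 2
          + (2 - (n : ℝ)) * ρ * c * p * (x i * y i)
          + ρ * ‖x‖ ^ 2 * c *
            (x i * ∑ j, partialDeriv i (partialDeriv j u) x * partialDeriv j u x)
          + ρ * ‖x‖ ^ 2 * c * (x i * ∑ j, partialDeriv i (partialDeriv j u) x * y j)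
          + ρ * ‖x‖ ^ 2 * c * p * partialDeriv i (partialDeriv i u) x := by
    calc ∑ j, partialDeriv j (curlField b c u i) x * partialDeriv i (partialDeriv j u) x
        = ∑ j, (((4 - (n : ℝ)) * ρ * ‖x‖ ^ 2 * b * partialDeriv i u x
              + (2 - (n : ℝ)) * ρ * c * p * x i) * (partialDeriv i (partialDeriv j u) x * x j)
          + ρ * (‖x‖ ^ 2) ^ 2 * b * partialDeriv i (partialDeriv j u) x ^ 2
          + (ρ * ‖x‖ ^ 2 * c * x i) *
            (partialDeriv i (partialDeriv j u) x * partialDeriv j u x)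
          + (ρ * ‖x‖ ^ 2 * c * x i) * (partialDeriv i (partialDeriv j u) x * y j)
          + (if i = j then ρ * ‖x‖ ^ 2 * c * p * partialDeriv i (partialDeriv j u) x
              else 0)) := by
          refine Finset.sum_congr rfl fun j _ => ?_
          rw [key]; split_ifs <;> ring
      _ = _ := by
          simp only [Finset.sum_add_distrib, ← Finset.mul_sum, hyx, Finset.sum_ite_eq,
            Finset.mem_univ, if_true]
          ring
  simp only [Finset.sum_sub_distrib, ← Finset.mul_sum, ← Finset.sum_mul, ← hT, hdiag, hoff,
    Finset.sum_add_distrib, hgH, hyH]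
  ring

end Identities

section Rellich

variable {n : ℕ} {u : EuclideanSpace ℝ (Fin n) → ℝ} {K : Set (EuclideanSpace ℝ (Fin n))}

namespace SmoothVanishingOff

theorem divField (hu : SmoothVanishingOff K 2 u) (hK : IsClosed K)
    (h0 : (0 : EuclideanSpace ℝ (Fin n)) ∉ K) (b c : ℝ) (i : Fin n) :
    SmoothVanishingOff K 1 (divField b c u i) := by
  have hd (j : Fin n) := hu.partialDeriv hK (k := 1) (by norm_num) j
  have hp : SmoothVanishingOff K 1 (radialDeriv u) :=
    sum fun j _ => (hd j).mul_left (contDiff_coord j)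
  have hG : SmoothVanishingOff K 1 (gradSq u) := by
    refine ⟨contDiff_gradSq hu.contDiff, fun x hx => Finset.sum_eq_zero fun j _ => ?_⟩
    simp [(hd j).eq_zero x hx]
  have hpx : SmoothVanishingOff K 1 fun x => radialDeriv u x * x i := by
    simpa only [mul_comm] using hp.mul_left (contDiff_coord i)
  exact ((hpx.mul_left (contDiff_const.mul hp.contDiff)).norm_rpow_mul hK h0 _).add
    (((hG.mul_left (contDiff_const.mul (contDiff_coord i))).add
      ((hd i).mul_left (contDiff_const.mul hp.contDiff))).norm_rpow_mul hK h0 _)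

theorem curlField (hu : SmoothVanishingOff K 2 u) (hK : IsClosed K)
    (h0 : (0 : EuclideanSpace ℝ (Fin n)) ∉ K) (b c : ℝ) (i : Fin n) :
    SmoothVanishingOff K 1 (curlField b c u i) := by
  have hd (j : Fin n) := hu.partialDeriv hK (k := 1) (by norm_num) j
  have hp : SmoothVanishingOff K 1 (radialDeriv u) :=
    sum fun j _ => (hd j).mul_left (contDiff_coord j)
  exact (((hd i).mul_left contDiff_const).norm_rpow_mul hK h0 _).add
    ((hp.mul_left (contDiff_const.mul (contDiff_coord i))).norm_rpow_mul hK h0 _)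

end SmoothVanishingOff

/-- The pointwise form of the inequality: the left-hand side has vanishing integral. -/
theorem div_add_curl_le (hn : 2 < n) (hu : ContDiff ℝ 2 u) {x : EuclideanSpace ℝ (Fin n)}
    (hx : x ≠ 0) {C : ℝ} (hC₁ : C ≤ ((n : ℝ) - 2) ^ 2) (hC₂ : C ≤ (n : ℝ) - 1) :
    ∑ i, partialDeriv i (divField (-(n + 1 + (n ^ 2 - 5 * n + 8) / (n - 2)) / 2)
        ((n ^ 2 - 5 * n + 8) / (n - 2)) u i) x
      + ∑ i, ∑ j, (partialDeriv i (curlField ((n - 1) / (n - 2)) (-2 / (n - 2)) u i) x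
          * partialDeriv j (partialDeriv j u) x
        - partialDeriv j (curlField ((n - 1) / (n - 2)) (-2 / (n - 2)) u i) x
          * partialDeriv i (partialDeriv j u) x)
      ≤ ‖x‖ ^ (4 - (n : ℝ)) * lap u x ^ 2
        - C * (‖x‖ ^ (2 - (n : ℝ)) * ‖gradient u x‖ ^ 2) := by
  have hρ : 0 < ‖x‖ ^ (-(n : ℝ)) := Real.rpow_pos_of_pos (norm_pos_iff.2 hx) _
  have hR : ‖x‖ ^ 2 = ∑ i, x i ^ 2 := EuclideanSpace.real_norm_sq_eq x
  have hRpos : 0 < ‖x‖ ^ 2 := pow_pos (norm_pos_iff.2 hx) 2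
  have hρ2 : ‖x‖ ^ (2 - (n : ℝ)) = ‖x‖ ^ (-(n : ℝ)) * ‖x‖ ^ 2 := by
    rw [← norm_rpow_add_two hx]; congr 1; ring
  have hρ4 : ‖x‖ ^ (4 - (n : ℝ)) = ‖x‖ ^ (-(n : ℝ)) * (‖x‖ ^ 2) ^ 2 := by
    rw [sq (‖x‖ ^ 2), ← mul_assoc, ← norm_rpow_add_two hx, ← norm_rpow_add_two hx]
    congr 1; ring
  rw [sum_partialDeriv_divField hu hx, sum_curl_curlField hu hx, lap_eq_sum_partialDeriv hu,
    norm_gradient_sq, hρ2, hρ4]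
  set H : Fin n → Fin n → ℝ := fun i j => partialDeriv i (partialDeriv j u) x with hH
  set y : Fin n → ℝ := fun i => ∑ j, H i j * x j with hy
  have h₁ : radialDeriv u x ^ 2 ≤ ‖x‖ ^ 2 * gradSq u x := by
    rw [hR]
    exact Finset.sum_mul_sq_le_sq_mul_sq Finset.univ _ _
  have h₂ : (radialDeriv u x + ∑ i, x i * y i) ^ 2
      ≤ ‖x‖ ^ 2 * (gradSq u x + 2 * (∑ i, partialDeriv i u x * y i) + ∑ i, y i ^ 2) := by
    have h := Finset.sum_mul_sq_le_sq_mul_sq Finset.univ (fun i => x i)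
      fun i => partialDeriv i u x + y i
    have e₁ : ∑ i, x i * (partialDeriv i u x + y i) = radialDeriv u x + ∑ i, x i * y i := by
      simp only [mul_add, Finset.sum_add_distrib, radialDeriv]
    have e₂ : ∑ i, (partialDeriv i u x + y i) ^ 2
        = gradSq u x + 2 * (∑ i, partialDeriv i u x * y i) + ∑ i, y i ^ 2 := by
      simp only [add_sq, mul_assoc, Finset.sum_add_distrib, ← Finset.mul_sum, gradSq]
    rwa [e₁, e₂, ← hR] at h
  have h₃ := sq_sum_mul_trace_sub_le (fun i => x i) y H
    (fun i j => partialDeriv_comm hu i j) (fun _ => rfl) (hR ▸ hRpos)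
  rw [← hR, Fintype.card_fin] at h₃
  have h := null_terms_le n (‖x‖ ^ 2) (radialDeriv u x) (∑ i, x i * y i) (gradSq u x)
    (∑ i, partialDeriv i u x * y i) (∑ i, y i ^ 2) (∑ i, H i i) (∑ i, ∑ j, H i j ^ 2) C
    (by exact_mod_cast hn) hC₁ hC₂ h₁ h₂ h₃
  have h' := mul_le_mul_of_nonneg_left h hρ.le
  rw [show ∑ i, partialDeriv i u x ^ 2 = gradSq u x from rfl]
  refine le_of_eq_of_le ?_ (h'.trans_eq ?_) <;> ring

theorem mul_integral_gradient_le (hn : 2 < n) (hu : SmoothVanishingOff K 2 u) (hK : IsCompact K)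
    (h0 : (0 : EuclideanSpace ℝ (Fin n)) ∉ K) {C : ℝ} (hC₁ : C ≤ ((n : ℝ) - 2) ^ 2)
    (hC₂ : C ≤ (n : ℝ) - 1) :
    C * ∫ x, ‖x‖ ^ (2 - (n : ℝ)) * ‖gradient u x‖ ^ 2
      ≤ ∫ x, ‖x‖ ^ (4 - (n : ℝ)) * lap u x ^ 2 := by
  have : Nonempty (Fin n) := ⟨⟨0, by omega⟩⟩
  have hd (j : Fin n) := hu.partialDeriv hK.isClosed (k := 1) (by norm_num) j
  have hdd (i j : Fin n) : SmoothVanishingOff K 0 (partialDeriv i (partialDeriv j u)) :=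
    (hd j).partialDeriv hK.isClosed (by norm_num) i
  have hL : SmoothVanishingOff K 0 fun x => lap u x ^ 2 := by
    simp only [sq, lap_eq_sum_partialDeriv hu.contDiff]
    have h : SmoothVanishingOff K 0 fun x => ∑ i, partialDeriv i (partialDeriv i u) x :=
      .sum fun i _ => hdd i i
    exact h.mul_left h.contDiff
  have hG : SmoothVanishingOff K 0 fun x => ‖gradient u x‖ ^ 2 := by
    simp only [norm_gradient_sq]
    simp only [sq]
    exact .sum fun i _ =>
      have h : SmoothVanishingOff K 0 (partialDeriv i u) :=
        ⟨(hd i).contDiff.of_le (by norm_num), (hd i).eq_zero⟩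
      h.mul_left h.contDiff
  have hLi := (hL.norm_rpow_mul hK.isClosed h0 (4 - (n : ℝ))).integrable hK
  have hGi := (hG.norm_rpow_mul hK.isClosed h0 (2 - (n : ℝ))).integrable hK
  set Z := divField (-((n : ℝ) + 1 + (n ^ 2 - 5 * n + 8) / (n - 2)) / 2)
    ((n ^ 2 - 5 * n + 8) / (n - 2)) u with hZ
  set F := curlField (((n : ℝ) - 1) / (n - 2)) (-2 / (n - 2)) u with hF
  have hZs (i : Fin n) : SmoothVanishingOff K 1 (Z i) := hu.divField hK.isClosed h0 _ _ i
  have hFs (i : Fin n) : SmoothVanishingOff K 1 (F i) := hu.curlField hK.isClosed h0 _ _ i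
  have hZi (i : Fin n) : Integrable fun x => partialDeriv i (Z i) x :=
    ((hZs i).partialDeriv hK.isClosed (k := 0) (by norm_num) i).integrable hK
  have hFi (i j k l : Fin n) :
      Integrable fun x => partialDeriv i (F j) x * partialDeriv k (partialDeriv l u) x :=
    ((hdd k l).mul_left ((hFs j).partialDeriv hK.isClosed (k := 0) (by norm_num) i).contDiff
      ).integrable hK
  have hFij (i j : Fin n) : Integrable fun x =>
      partialDeriv i (F i) x * partialDeriv j (partialDeriv j u) x
        - partialDeriv j (F i) x * partialDeriv i (partialDeriv j u) x :=
    (hFi i i j j).sub (hFi j i i j)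
  have hcurl : Integrable fun x => ∑ i, ∑ j,
      (partialDeriv i (F i) x * partialDeriv j (partialDeriv j u) x
        - partialDeriv j (F i) x * partialDeriv i (partialDeriv j u) x) :=
    integrable_finsetSum _ fun i _ => integrable_finsetSum _ fun j _ => hFij i j
  have hdiv : Integrable fun x => ∑ i, partialDeriv i (Z i) x :=
    integrable_finsetSum _ fun i _ => hZi i
  have hzero : ∫ x, (∑ i, partialDeriv i (Z i) x + ∑ i, ∑ j,
      (partialDeriv i (F i) x * partialDeriv j (partialDeriv j u) x
        - partialDeriv j (F i) x * partialDeriv i (partialDeriv j u) x)) = 0 := by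
    rw [integral_add hdiv hcurl, integral_finsetSum _ fun i _ => hZi i,
      integral_finsetSum _ fun i _ => integrable_finsetSum _ fun j _ => hFij i j,
      Finset.sum_eq_zero fun i _ => (hZs i).integral_partialDeriv_eq_zero hK i,
      Finset.sum_eq_zero, add_zero]
    intro i _
    rw [integral_finsetSum _ fun j _ => hFij i j]
    refine Finset.sum_eq_zero fun j _ => ?_
    rw [integral_sub (hFi i i j j) (hFi j i i j),
      (hFs i).integral_partialDeriv_mul_comm (hd j) hK i j, sub_self]
  rw [← sub_nonneg, ← integral_const_mul, ← integral_sub hLi (hGi.const_mul C), ← hzero]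
  refine integral_mono_ae (hdiv.add hcurl) (hLi.sub (hGi.const_mul C)) ?_
  filter_upwards [Measure.ae_ne volume (0 : EuclideanSpace ℝ (Fin n))] with x hx
  exact div_add_curl_le hn hu.contDiff hx hC₁ hC₂

end Rellich

theorem statement3 (n : ℕ) (hn : 2 ≤ n)
    (u : EuclideanSpace ℝ (Fin n) → ℝ)
    (hu : ContDiff ℝ 2 u) (hcs : HasCompactSupport u)
    (h0 : (0 : EuclideanSpace ℝ (Fin n)) ∉ tsupport u) :
    (∫ x : EuclideanSpace ℝ (Fin n), ‖x‖ ^ (4 - (n : ℝ)) * (lap u x) ^ 2) ≥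
      min (((n : ℝ) - 2) ^ 2) ((n : ℝ) - 1) *
        (∫ x : EuclideanSpace ℝ (Fin n), ‖x‖ ^ (2 - (n : ℝ)) * ‖gradient u x‖ ^ 2) := by
  rcases hn.eq_or_lt with rfl | hn
  · rw [min_eq_left (by norm_num)]
    norm_num
    positivity
  · exact mul_integral_gradient_le hn ⟨hu, fun x hx => image_eq_zero_of_notMem_tsupport hx⟩
      hcs h0 (min_le_left _ _) (min_le_right _ _)
end
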